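/- Let C be a connected groupoid with object x, and let p₁ : C̃₁ ⥤ C and p₂ : C̃₂ ⥤ C be covering morphisms of groupoids with C̃₁ and C̃₂ connected. Suppose x̃₁ is an object of C̃₁ and x̃₂ is an object of C̃₂ with p₁(x̃₁) = x = p₂(x̃₂), and suppose the image of the vertex group C̃₁(x̃₁) under p₁ equals the image of the vertex group C̃₂(x̃₂) under p₂, as subgroups of the vertex group C(x). Then there is an isomorphism of groupoids φ : C̃₁ ≅ C̃₂ with p₂ ∘ φ = p₁ and φ(x̃₁) = x̃₂. -/

import Mathlib

open CategoryTheory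

/-- The map induced by a functor `p` from the costar of `y` (all morphisms with target `y`)
to the costar of `p.obj y`. -/
def costarMap {H G : Type*} [Groupoid H] [Groupoid G] (p : H ⥤ G) (y : H) :
    (Σ u : H, u ⟶ y) → Σ v : G, v ⟶ p.obj y :=
  fun z => ⟨p.obj z.1, p.map z.2⟩

/-- A morphism of groupoids is a covering morphism if it induces a bijection on all costars. -/
def IsCoveringMorphism {H G : Type*} [Groupoid H] [Groupoid G] (p : H ⥤ G) : Prop :=
  ∀ y : H, Function.Bijective (costarMap p y)

/-- A groupoid is connected if there is a morphism between any two of its objects. -/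
def GroupoidConnected (F : Type*) [Groupoid F] : Prop :=
  ∀ x y : F, Nonempty (x ⟶ y)

namespace IsCoveringMorphism

variable {D G H : Type*} [Groupoid D] [Groupoid G] [Groupoid H] {p : H ⥤ G}

theorem eq_of_map_heq (hp : IsCoveringMorphism p) {y u u' : H} {f : u ⟶ y} {f' : u' ⟶ y}
    (hu : p.obj u = p.obj u') (hf : p.map f ≍ p.map f') : u = u' ∧ f ≍ f' := by
  have h : (⟨u, f⟩ : Σ u : H, u ⟶ y) = ⟨u', f'⟩ := (hp y).1 (Sigma.ext hu hf)
  exact Sigma.mk.inj_iff.1 h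

theorem map_injective (hp : IsCoveringMorphism p) {u y : H} {f f' : u ⟶ y}
    (hf : p.map f = p.map f') : f = f' :=
  eq_of_heq (hp.eq_of_map_heq rfl (heq_of_eq hf)).2

theorem exists_lift (hp : IsCoveringMorphism p) {y : H} {c : G} (v : c ⟶ p.obj y) :
    ∃ (u : H) (hu : p.obj u = c) (f : u ⟶ y), p.map f = eqToHom hu ≫ v := by
  obtain ⟨⟨u, f⟩, h⟩ := (hp y).2 ⟨c, v⟩
  obtain ⟨rfl, h⟩ := Sigma.mk.inj_iff.1 h
  exact ⟨u, rfl, f, by simpa using eq_of_heq h⟩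

/-- Lifts of a functor through a covering morphism are determined by their value at one object. -/
theorem lift_unique (hp : IsCoveringMorphism p) (hD : GroupoidConnected D) {φ ψ : D ⥤ H}
    (h : φ ⋙ p = ψ ⋙ p) {x : D} (hx : φ.obj x = ψ.obj x) : φ = ψ := by
  have key {y z : D} (f : y ⟶ z) (hz : φ.obj z = ψ.obj z) :
      φ.obj y = ψ.obj y ∧ φ.map f ≍ ψ.map f := by
    have hy : p.obj (φ.obj y) = p.obj (ψ.obj y) := Functor.congr_obj h y
    have hf : p.map (φ.map f) ≍ p.map (ψ.map f) := Functor.hcongr_hom h f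
    generalize φ.map f = a at *
    generalize ψ.map f = b at *
    generalize φ.obj z = t at *
    subst hz
    exact hp.eq_of_map_heq hy hf
  have hobj (y : D) : φ.obj y = ψ.obj y := (key (hD y x).some hx).1
  exact Functor.hext hobj fun _ z f => (key f (hobj z)).2

/-- A functor from a connected groupoid lifts through a covering morphism as soon as the image
of a vertex group is contained in the image of a vertex group of the covering groupoid. -/
theorem exists_functor_lift (hp : IsCoveringMorphism p) (hD : GroupoidConnected D) (q : D ⥤ G)
    {x : D} {y : H} (h : q.obj x = p.obj y)
    (hle : ∀ a : x ⟶ x, ∃ b : y ⟶ y, p.map b = eqToHom h.symm ≫ q.map a ≫ eqToHom h) :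
    ∃ φ : D ⥤ H, φ ⋙ p = q ∧ φ.obj x = y := by
  have u (d : D) : d ⟶ x := (hD d x).some
  choose z hz w hw using fun d => hp.exists_lift (q.map (u d) ≫ eqToHom h)
  have hmap {d e : D} (f : d ⟶ e) :
      ∃ g : z d ⟶ z e, p.map g = eqToHom (hz d) ≫ q.map f ≫ eqToHom (hz e).symm := by
    obtain ⟨b, hb⟩ := hle (inv (u d) ≫ f ≫ u e)
    refine ⟨w d ≫ b ≫ inv (w e), ?_⟩
    rw [← cancel_mono (p.map (w e)), ← p.map_comp]
    simp [hw, hb]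
  choose m hm using @hmap
  let φ : D ⥤ H :=
    { obj := z
      map := m
      map_id := fun d => hp.map_injective (by simp [hm])
      map_comp := fun f g => hp.map_injective (by simp [hm]) }
  refine ⟨φ, CategoryTheory.Functor.ext hz fun _ _ f => hm f, ?_⟩
  obtain ⟨b, hb⟩ := hle (u x)
  refine (hp.eq_of_map_heq (f := w x) (f' := b) ((hz x).trans h) ?_).1
  rw [hw, hb]
  exact (eqToHom_comp_heq _ _).trans (eqToHom_comp_heq _ _).symm

end IsCoveringMorphism

/-- two connected covering morphisms of a connected groupoid `C` whose
characteristic subgroups at compatible base points coincide are isomorphic over `C`,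
via an isomorphism of groupoids (a functor with a strict inverse) preserving base points. -/
theorem covering_iso_of_eq_image_vertexGroup
    {C C₁ C₂ : Type*} [Groupoid C] [Groupoid C₁] [Groupoid C₂]
    (hC : GroupoidConnected C) (x : C)
    (p₁ : C₁ ⥤ C) (p₂ : C₂ ⥤ C)
    (hp₁ : IsCoveringMorphism p₁) (hp₂ : IsCoveringMorphism p₂)
    (hC₁ : GroupoidConnected C₁) (hC₂ : GroupoidConnected C₂)
    (x₁ : C₁) (x₂ : C₂) (h₁ : p₁.obj x₁ = x) (h₂ : p₂.obj x₂ = x)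
    (himg :
      {g : x ⟶ x | ∃ a : x₁ ⟶ x₁, eqToHom h₁.symm ≫ p₁.map a ≫ eqToHom h₁ = g} =
      {g : x ⟶ x | ∃ b : x₂ ⟶ x₂, eqToHom h₂.symm ≫ p₂.map b ≫ eqToHom h₂ = g}) :
    ∃ (φ : C₁ ⥤ C₂) (ψ : C₂ ⥤ C₁),
      φ ⋙ ψ = 𝟭 C₁ ∧ ψ ⋙ φ = 𝟭 C₂ ∧ φ ⋙ p₂ = p₁ ∧ φ.obj x₁ = x₂ := by
  obtain ⟨φ, hφ, hφx⟩ := hp₂.exists_functor_lift hC₁ p₁ (h₁.trans h₂.symm) fun a => by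
    obtain ⟨b, hb⟩ := himg.subset ⟨a, rfl⟩
    refine ⟨b, ?_⟩
    rw [← cancel_epi (eqToHom h₂.symm), ← cancel_mono (eqToHom h₂)]
    simpa using hb
  obtain ⟨ψ, hψ, hψx⟩ := hp₁.exists_functor_lift hC₂ p₂ (h₂.trans h₁.symm) fun b => by
    obtain ⟨a, ha⟩ := himg.superset ⟨b, rfl⟩
    refine ⟨a, ?_⟩
    rw [← cancel_epi (eqToHom h₁.symm), ← cancel_mono (eqToHom h₁)]
    simpa using ha
  refine ⟨φ, ψ, hp₁.lift_unique hC₁ (x := x₁) ?_ ?_, hp₂.lift_unique hC₂ (x := x₂) ?_ ?_,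
    hφ, hφx⟩
  · rw [Functor.assoc, hψ, hφ, Functor.id_comp]
  · simp [hφx, hψx]
  · rw [Functor.assoc, hφ, hψ, Functor.id_comp]
  · simp [hφx, hψx]
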